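/- arXiv:2003.00815 — 2 statements merged into one kernel-verified Lean document; each statement's English description precedes it below -/
import Mathlib

section
/- If 𝔫 ∈ A₊ satisfies q < t(𝔫) ≤ 2q, where t(𝔫) is the number of distinct monic prime factors of 𝔫, then τ(𝔫) = 1. -/
open Polynomial Matrix

noncomputable section

namespace SturmFF

variable (Fq : Type) [Field Fq] [Fintype Fq]

/-- The local field `K_∞ = 𝔽_q((π_∞))`. -/
abbrev Kinf := LaurentSeries Fq

/-- The uniformizer `π_∞`. -/
def piInf : Kinf Fq := HahnSeries.single 1 1

/-- The element `θ = π_∞⁻¹` of `K_∞`. -/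
def thetaK : Kinf Fq := HahnSeries.single (-1) 1

/-- The embedding `A = 𝔽_q[θ] → K_∞` sending `θ` to `π_∞⁻¹`. -/
def polyToK : Polynomial Fq →+* Kinf Fq := (Polynomial.aeval (thetaK Fq)).toRingHom

/-- Membership in the valuation ring `O_∞ = 𝔽_q[[π_∞]]`. -/
def memO (x : Kinf Fq) : Prop := ∀ n : ℤ, n < 0 → x.coeff n = 0

/-- A matrix has all entries in `O_∞`. -/
def MatO (κ : Matrix (Fin 2) (Fin 2) (Kinf Fq)) : Prop := ∀ i j, memO Fq (κ i j)

/-- Membership in `GL₂(O_∞)`: entries in `O_∞` and determinant a unit of `O_∞`. -/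
def InGLO (κ : Matrix (Fin 2) (Fin 2) (Kinf Fq)) : Prop :=
  MatO Fq κ ∧ κ.det.coeff 0 ≠ 0

/-- Membership in the Iwahori subgroup `I_∞ ⊆ GL₂(O_∞)`. -/
def InIw (κ : Matrix (Fin 2) (Fin 2) (Kinf Fq)) : Prop :=
  InGLO Fq κ ∧ ∀ n : ℤ, n < 1 → (κ 1 0).coeff n = 0

/-- The matrix `diag(θ^r, 1)`. -/
def Dmat (r : ℕ) : Matrix (Fin 2) (Fin 2) (Kinf Fq) := !![thetaK Fq ^ r, 0; 0, 1]

/-- The matrix `(0, 1; π_∞, 0)`. -/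
def Jmat : Matrix (Fin 2) (Fin 2) (Kinf Fq) := !![0, 1; piInf Fq, 0]

/-- The Atkin–Lehner/Fricke matrix `w_𝔫 = (0, -1; 𝔫, 0)`. -/
def wmat (𝔫 : Polynomial Fq) : Matrix (Fin 2) (Fin 2) (Kinf Fq) :=
  !![0, -1; polyToK Fq 𝔫, 0]

/-- Membership in the Hecke congruence subgroup `Γ₀(𝔫) ⊆ GL₂(A)`. -/
def InGamma0 (𝔫 : Polynomial Fq) (γ : Matrix (Fin 2) (Fin 2) (Polynomial Fq)) : Prop :=
  IsUnit γ.det ∧ 𝔫 ∣ γ 1 0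

/-- A `Γ₀(𝔫)`-invariant harmonic cochain, viewed as a function on `GL₂(K_∞)`
(encoded as a function on all matrices, with the conditions imposed on invertible ones). -/
def Harmonic (𝔫 : Polynomial Fq) (f : Matrix (Fin 2) (Fin 2) (Kinf Fq) → ℂ) : Prop :=
  (∀ g : Matrix (Fin 2) (Fin 2) (Kinf Fq), g.det ≠ 0 →
    ∀ γ : Matrix (Fin 2) (Fin 2) (Polynomial Fq), InGamma0 Fq 𝔫 γ →
    ∀ z : Kinf Fq, z ≠ 0 → ∀ κ : Matrix (Fin 2) (Fin 2) (Kinf Fq), InIw Fq κ →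
      f (γ.map (polyToK Fq) * g * (z • (1 : Matrix (Fin 2) (Fin 2) (Kinf Fq))) * κ) = f g)
  ∧ (∀ g : Matrix (Fin 2) (Fin 2) (Kinf Fq), g.det ≠ 0 → f (g * Jmat Fq) = - f g)
  ∧ (∀ g : Matrix (Fin 2) (Fin 2) (Kinf Fq), g.det ≠ 0 →
      (∑ ε : Fq, f (g * !![1, 0; polyToK Fq (Polynomial.C ε), 1])) + f (g * !![0, 1; 1, 0]) = 0)

/-- A harmonic cochain is cuspidal if it is finitely supported modulo
`Γ₀(𝔫)` on the left and `K_∞^× I_∞` on the right. -/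
def Cuspidal (𝔫 : Polynomial Fq) (f : Matrix (Fin 2) (Fin 2) (Kinf Fq) → ℂ) : Prop :=
  ∃ S : Finset (Matrix (Fin 2) (Fin 2) (Kinf Fq)),
    ∀ g : Matrix (Fin 2) (Fin 2) (Kinf Fq), g.det ≠ 0 → f g ≠ 0 →
      ∃ s ∈ S, ∃ γ : Matrix (Fin 2) (Fin 2) (Polynomial Fq), InGamma0 Fq 𝔫 γ ∧
        ∃ z : Kinf Fq, z ≠ 0 ∧ ∃ κ : Matrix (Fin 2) (Fin 2) (Kinf Fq), InIw Fq κ ∧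
          g = γ.map (polyToK Fq) * s * (z • (1 : Matrix (Fin 2) (Fin 2) (Kinf Fq))) * κ

/-- The additive character `ψ` of `K_∞`. -/
def psi (x : Kinf Fq) : ℂ :=
  letI := ZMod.algebra Fq (ringChar Fq)
  Complex.exp (2 * Real.pi * Complex.I *
    ((Algebra.trace (ZMod (ringChar Fq)) Fq (x.coeff 1)).val : ℂ) / (ringChar Fq : ℂ))

/-- The constant Fourier coefficient `c₀(f)`. -/
def c0 (f : Matrix (Fin 2) (Fin 2) (Kinf Fq) → ℂ) : ℂ :=
  (Fintype.card Fq : ℂ)⁻¹ *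
    ∑ c : Fq, f !![piInf Fq ^ 2, polyToK Fq (Polynomial.C c) * piInf Fq; 0, 1]

/-- The element `u = Σ_{i=1}^{d+1} c_i π_∞^i` of `K_∞` attached to a tuple of coefficients. -/
def uOf (d : ℕ) (c : Fin (d + 1) → Fq) : Kinf Fq :=
  ∑ i : Fin (d + 1), HahnSeries.single ((i : ℤ) + 1) (c i)

/-- The Fourier coefficient `c_𝔪(f)` for a monic polynomial `𝔪`. -/
def cm (𝔪 : Polynomial Fq) (f : Matrix (Fin 2) (Fin 2) (Kinf Fq) → ℂ) : ℂ :=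
  (Fintype.card Fq : ℂ)⁻¹ *
    ∑ c : Fin (𝔪.natDegree + 1) → Fq,
      f !![piInf Fq ^ (𝔪.natDegree + 2), uOf Fq 𝔪.natDegree c; 0, 1] *
        psi Fq (-(polyToK Fq 𝔪 * uOf Fq 𝔪.natDegree c))

/-- `δ_𝔫(c,d)`: the least `m` such that some `x, y` of degree at most `m`
satisfy `gcd(cx + dy, 𝔫) = 1`. -/
def deltaN (𝔫 c d : Polynomial Fq) : ℕ :=
  sInf { m : ℕ | ∃ x y : Polynomial Fq, x.degree ≤ (m : WithBot ℕ) ∧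
    y.degree ≤ (m : WithBot ℕ) ∧ IsCoprime (c * x + d * y) 𝔫 }

open Classical in
/-- `ε_𝔫(c,d) ∈ {0,1}`. -/
def epsN (𝔫 c d : Polynomial Fq) : ℕ :=
  if ∃ x₀ y₀ : Polynomial Fq, y₀.degree < x₀.degree ∧
      x₀.degree = (deltaN Fq 𝔫 c d : WithBot ℕ) ∧ IsCoprime (c * x₀ + d * y₀) 𝔫
  then 0 else 1

/-- The set `S(c,d;m)`. -/
def Sset (c d : Polynomial Fq) (m : ℕ) : Set (Polynomial Fq) :=
  { z | ∃ x y : Polynomial Fq, x.degree ≤ (m : WithBot ℕ) ∧ y.degree ≤ (m : WithBot ℕ) ∧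
      z = x * c + y * d }

/-- `t(c,d;m)`: the largest cardinality of a pairwise-coprime subset of `S(c,d;m)`. -/
def tcd (c d : Polynomial Fq) (m : ℕ) : ℕ :=
  sSup { n : ℕ | ∃ S' : Finset (Polynomial Fq), ↑S' ⊆ Sset Fq c d m ∧
    (∀ a ∈ S', ∀ b ∈ S', a ≠ b → IsCoprime a b) ∧ S'.card = n }

/-- `t(m,n) ∈ ℕ∞`. -/
def tmn (m n : ℕ) : ℕ∞ :=
  sInf { k : ℕ∞ | ∃ c d : Polynomial Fq, IsCoprime c d ∧
    ((m : WithBot ℕ) + 1) < max c.degree d.degree ∧ max c.degree d.degree < (n : WithBot ℕ) ∧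
    k = (tcd Fq c d m : ℕ∞) }

/-- `t(𝔫)`: the number of distinct monic prime factors of `𝔫`. -/
def tPrimes (𝔫 : Polynomial Fq) : ℕ :=
  Set.ncard { p : Polynomial Fq | p.Monic ∧ Irreducible p ∧ p ∣ 𝔫 }

/-- `τ(𝔫)`. -/
def tauN (𝔫 : Polynomial Fq) : ℕ :=
  sInf { m : ℕ | (tPrimes Fq 𝔫 : ℕ∞) < tmn Fq m 𝔫.natDegree }

section Counting

/-- Among the non-vertical lines `y = l.1 * x + l.2` of the affine plane over a finite field with
`q ≥ 3` elements one can choose `2q` such that no point of the graph of `g` away from `x = 0` lies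
on two of them. -/
lemma exists_lines_of_three_le_card {F : Type*} [Field F] [Fintype F] (hq : 3 ≤ Fintype.card F)
    (g : F → F) :
    ∃ L : Finset (F × F), 2 * Fintype.card F ≤ L.card ∧
      ∀ l ∈ L, ∀ l' ∈ L, l ≠ l' → ∀ t : F, t ≠ 0 →
        ¬ (l.1 * t + l.2 = g t ∧ l'.1 * t + l'.2 = g t) := by
  classical
  have hne : ∀ a b : F, ∃ t, t ≠ a ∧ t ≠ b := by
    intro a b
    have h : ({a, b} : Finset F).card < (Finset.univ : Finset F).card := by
      rw [Finset.card_univ]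
      exact lt_of_le_of_lt Finset.card_le_two (by omega)
    obtain ⟨t, -, ht⟩ := Finset.exists_mem_notMem_of_card_lt_card h
    simp only [Finset.mem_insert, Finset.mem_singleton, not_or] at ht
    exact ⟨t, ht⟩
  have hcard : (Finset.univ.erase (0 : F)).card = Fintype.card F - 1 := by
    rw [Finset.card_erase_of_mem (Finset.mem_univ _), Finset.card_univ]
  have hmiss : ∀ a : F, ∃ s : F, ∀ t, t ≠ 0 → a * t + s ≠ g t := by
    intro a
    have h : ((Finset.univ.erase (0 : F)).image fun t => g t - a * t).card
        < (Finset.univ : Finset F).card := by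
      refine lt_of_le_of_lt Finset.card_image_le ?_
      rw [hcard, Finset.card_univ]
      omega
    obtain ⟨s, -, hs⟩ := Finset.exists_mem_notMem_of_card_lt_card h
    refine ⟨s, fun t ht h => hs (Finset.mem_image.2 ⟨t, by simpa using ht, ?_⟩)⟩
    rw [← h]
    ring
  choose m hm using hmiss
  obtain ⟨u, hu0, hu1⟩ := hne 0 1
  have hu1' : u - 1 ≠ 0 := sub_ne_zero.2 hu1
  set a₁ : F := (g u - g 1) / (u - 1) with ha₁
  have ha₁' : g u - a₁ * u = g 1 - a₁ * 1 := by
    rw [ha₁]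
    field_simp
    ring
  obtain ⟨s₁, hs₁m, hs₁⟩ : ∃ s, s ≠ m a₁ ∧ ∀ t, t ≠ 0 → a₁ * t + s ≠ g t := by
    have h : (insert (m a₁) (((Finset.univ.erase (0 : F)).erase u).image
        fun t => g t - a₁ * t)).card < (Finset.univ : Finset F).card := by
      refine lt_of_le_of_lt (Finset.card_insert_le _ _) ?_
      have h1 := Finset.card_image_le (s := (Finset.univ.erase (0 : F)).erase u)
        (f := fun t => g t - a₁ * t)
      rw [Finset.card_erase_of_mem (by simpa using hu0), hcard] at h1
      rw [Finset.card_univ]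
      omega
    obtain ⟨s, -, hs⟩ := Finset.exists_mem_notMem_of_card_lt_card h
    rw [Finset.mem_insert, not_or] at hs
    have hs' : ∀ t, t ≠ 0 → t ≠ u → a₁ * t + s ≠ g t := fun t ht htu h =>
      hs.2 (Finset.mem_image.2 ⟨t, by simp [ht, htu], by rw [← h]; ring⟩)
    refine ⟨s, hs.1, fun t ht h => ?_⟩
    by_cases htu : t = u
    · subst htu
      exact hs' 1 one_ne_zero (Ne.symm hu1) (by linear_combination h + ha₁')
    · exact hs' t ht htu h
  obtain ⟨a₀, ha₀, -⟩ := hne a₁ a₁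
  set L₀ : Finset (F × F) := Finset.univ.image fun s => (a₀, s)
  set L₁ : Finset (F × F) := (Finset.univ.erase a₀).image fun a => (a, m a)
  have hL₀ : L₀.card = Fintype.card F :=
    Finset.card_image_of_injective _ fun s s' h => (Prod.ext_iff.1 h).2
  have hL₁ : L₁.card = Fintype.card F - 1 := by
    rw [Finset.card_image_of_injective _ fun s s' h => (Prod.ext_iff.1 h).1,
      Finset.card_erase_of_mem (Finset.mem_univ _), Finset.card_univ]
  have hdisj : Disjoint L₀ L₁ := by
    rw [Finset.disjoint_left]
    simp only [L₀, L₁, Finset.mem_image, Finset.mem_univ, true_and, Finset.mem_erase, and_true]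
    rintro _ ⟨s, rfl⟩ ⟨a, ha, h⟩
    exact ha (Prod.ext_iff.1 h).1
  have hnot : (a₁, s₁) ∉ L₀ ∪ L₁ := by
    simp only [L₀, L₁, Finset.mem_union, Finset.mem_image, Finset.mem_univ, true_and,
      Finset.mem_erase, and_true, Prod.mk.injEq]
    rintro (⟨s, h, -⟩ | ⟨a, -, rfl, h⟩)
    · exact ha₀ h
    · exact hs₁m h.symm
  have hmem : ∀ l ∈ insert (a₁, s₁) (L₀ ∪ L₁),
      l.1 = a₀ ∨ ∀ t, t ≠ 0 → l.1 * t + l.2 ≠ g t := by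
    simp only [L₀, L₁, Finset.mem_insert, Finset.mem_union, Finset.mem_image, Finset.mem_univ,
      true_and, Finset.mem_erase, and_true]
    rintro l (rfl | ⟨s, rfl⟩ | ⟨a, -, rfl⟩)
    · exact Or.inr hs₁
    · exact Or.inl rfl
    · exact Or.inr (hm a)
  refine ⟨insert (a₁, s₁) (L₀ ∪ L₁), ?_, ?_⟩
  · rw [Finset.card_insert_of_notMem hnot, Finset.card_union_of_disjoint hdisj, hL₀, hL₁]
    omega
  · rintro l hl l' hl' hne t ht ⟨h, h'⟩
    rcases hmem l hl with h1 | h1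
    · rcases hmem l' hl' with h2 | h2
      · refine hne (Prod.ext (h1.trans h2.symm) ?_)
        rw [h1] at h
        rw [h2] at h'
        linear_combination h - h'
      · exact h2 t ht h'
    · exact h1 t ht h

end Counting

section Coprimality

variable {F : Type*} [Field F]

lemma isCoprime_of_isCoprime_det {R : Type*} [CommRing R] {c d x y x' y' : R}
    (hcd : IsCoprime c d) (h : IsCoprime (x * c + y * d) (x * y' - x' * y)) :
    IsCoprime (x * c + y * d) (x' * c + y' * d) := by
  obtain ⟨u, v, huv⟩ := hcd
  have hdet : x * y' - x' * y =
      (v * x - u * y) * (x' * c + y' * d) + (x * c + y * d) * (u * y' - v * x') := by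
    linear_combination (-(x * y' - x' * y)) * huv
  rw [hdet] at h
  exact h.of_add_mul_left_right.of_mul_right_right

lemma isCoprime_X_sub_C_of_eval_ne_zero {f : F[X]} {a : F} (h : f.eval a ≠ 0) :
    IsCoprime f (X - C a) := by
  refine ((irreducible_X_sub_C a).coprime_iff_not_dvd.2 ?_).symm
  rwa [dvd_iff_isRoot]

/-- Two combinations `(l.1 θ + l.2) c + d` are coprime unless both vanish at some point. -/
lemma isCoprime_line_combination {c d : F[X]} (hcd : IsCoprime c d) {l l' : F × F} (hne : l ≠ l')
    (h : ∀ t : F, c.eval t ≠ 0 →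
      ¬ (l.1 * t + l.2 = - d.eval t / c.eval t ∧ l'.1 * t + l'.2 = - d.eval t / c.eval t)) :
    IsCoprime ((C l.1 * X + C l.2) * c + 1 * d) ((C l'.1 * X + C l'.2) * c + 1 * d) := by
  refine isCoprime_of_isCoprime_det hcd ?_
  have hdet : (C l.1 * X + C l.2) * 1 - (C l'.1 * X + C l'.2) * 1 =
      C (l.1 - l'.1) * X + C (l.2 - l'.2) := by
    rw [C_sub, C_sub]
    ring
  rw [hdet]
  by_cases h1 : l.1 = l'.1
  · have h2 : l.2 - l'.2 ≠ 0 := sub_ne_zero.2 fun h2 => hne (Prod.ext h1 h2)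
    rw [h1, sub_self, C_0, zero_mul, zero_add]
    exact isCoprime_one_right.of_isCoprime_of_dvd_right
      (isUnit_C.2 (isUnit_iff_ne_zero.2 h2)).dvd
  · have h2 : l.1 - l'.1 ≠ 0 := sub_ne_zero.2 h1
    set t : F := -(l.2 - l'.2) / (l.1 - l'.1) with ht
    have hteq : (l.1 - l'.1) * t = -(l.2 - l'.2) := by
      rw [ht]
      field_simp
    have hfac : C (l.1 - l'.1) * X + C (l.2 - l'.2) = C (l.1 - l'.1) * (X - C t) := by
      rw [mul_sub, ← C_mul, hteq, C_neg]
      ring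
    rw [hfac]
    refine IsCoprime.mul_right ?_ (isCoprime_X_sub_C_of_eval_ne_zero fun h0 => ?_)
    · exact isCoprime_one_right.of_isCoprime_of_dvd_right
        (isUnit_C.2 (isUnit_iff_ne_zero.2 h2)).dvd
    · have h0' : (l.1 * t + l.2) * c.eval t + d.eval t = 0 := by simpa using h0
      have hct : c.eval t ≠ 0 := by
        intro hc
        obtain ⟨u, v, huv⟩ := hcd
        have := congrArg (eval t) huv
        rw [hc, mul_zero, zero_add] at h0'
        simp [hc, h0'] at this
      have hl : l.1 * t + l.2 = - d.eval t / c.eval t := by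
        rw [eq_div_iff hct]
        linear_combination h0'
      exact h t hct ⟨hl, by rw [← hl]; linear_combination -hteq⟩

end Coprimality

section PairwiseCoprime

variable {F : Type} [Field F]

/-- The pairs `(c, d)` for which `(x, y) ↦ x c + y d` is injective on polynomials of degree at
most `1`. -/
def IndepLinear (c d : F[X]) : Prop :=
  ∀ x y : F[X], x.degree ≤ 1 → y.degree ≤ 1 → x * c + y * d = 0 → x = 0 ∧ y = 0

/-- `S(c,d;1)` contains `k` pairwise coprime elements. -/
def HasCoprimeFamily (k : ℕ) (c d : F[X]) : Prop :=
  ∃ S' : Finset F[X], ↑S' ⊆ Sset F c d 1 ∧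
    (∀ a ∈ S', ∀ b ∈ S', a ≠ b → IsCoprime a b) ∧ k ≤ S'.card

lemma IndepLinear.swap {c d : F[X]} (h : IndepLinear c d) : IndepLinear d c :=
  fun x y hx hy hxy => (h y x hy hx (by rw [add_comm, hxy])).symm

lemma degree_add_C_mul_le {x y : F[X]} {n : WithBot ℕ} (hx : x.degree ≤ n) (hy : y.degree ≤ n)
    (a : F) : (x + C a * y).degree ≤ n :=
  (degree_add_le _ _).trans (max_le hx (by
    rw [← smul_eq_C_mul]
    exact (degree_smul_le a y).trans hy))

lemma IndepLinear.shear {c d : F[X]} (h : IndepLinear c d) (a : F) :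
    IndepLinear c (d + C a * c) := by
  intro x y hx hy hxy
  obtain ⟨h1, h2⟩ := h (x + C a * y) y (degree_add_C_mul_le hx hy a) hy (by
    rw [← hxy]
    ring)
  rw [h2, mul_zero, add_zero] at h1
  exact ⟨h1, h2⟩

lemma HasCoprimeFamily.swap {k : ℕ} {c d : F[X]} (h : HasCoprimeFamily k c d) :
    HasCoprimeFamily k d c := by
  obtain ⟨S', hS, hrest⟩ := h
  refine ⟨S', fun z hz => ?_, hrest⟩
  obtain ⟨x, y, hx, hy, rfl⟩ := hS hz
  exact ⟨y, x, hy, hx, add_comm _ _⟩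

lemma HasCoprimeFamily.of_shear {k : ℕ} {c d : F[X]} {a : F}
    (h : HasCoprimeFamily k c (d + C a * c)) : HasCoprimeFamily k c d := by
  obtain ⟨S', hS, hrest⟩ := h
  refine ⟨S', fun z hz => ?_, hrest⟩
  obtain ⟨x, y, hx, hy, rfl⟩ := hS hz
  exact ⟨x + C a * y, y, degree_add_C_mul_le hx hy a, hy, by ring⟩

/-- An injective finite family of coefficient pairs with pairwise coprime combinations gives a
coprime family of the same size. -/
lemma hasCoprimeFamily_of_index {ι : Type*} {c d : F[X]} (hI : IndepLinear c d) (I : Finset ι)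
    (x y : ι → F[X]) (hx : ∀ i, (x i).degree ≤ 1) (hy : ∀ i, (y i).degree ≤ 1)
    (hinj : ∀ i j, x i = x j → y i = y j → i = j)
    (hcop : ∀ i ∈ I, ∀ j ∈ I, i ≠ j → IsCoprime (x i * c + y i * d) (x j * c + y j * d)) :
    HasCoprimeFamily I.card c d := by
  classical
  refine ⟨I.image fun i => x i * c + y i * d, ?_, ?_, ?_⟩
  · intro z hz
    obtain ⟨i, -, rfl⟩ := Finset.mem_image.1 (Finset.mem_coe.1 hz)
    exact ⟨x i, y i, hx i, hy i, rfl⟩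
  · intro a ha b hb hab
    obtain ⟨i, hi, rfl⟩ := Finset.mem_image.1 ha
    obtain ⟨j, hj, rfl⟩ := Finset.mem_image.1 hb
    exact hcop i hi j hj fun h => hab (by rw [h])
  · rw [Finset.card_image_of_injective]
    intro i j hij
    have h := hI (x i - x j) (y i - y j) ((degree_sub_le _ _).trans (max_le (hx i) (hx j)))
      ((degree_sub_le _ _).trans (max_le (hy i) (hy j))) (by
        have hij' : x i * c + y i * d = x j * c + y j * d := hij
        linear_combination hij')
    exact hinj i j (sub_eq_zero.1 h.1) (sub_eq_zero.1 h.2)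

lemma HasCoprimeFamily.mono {k l : ℕ} {c d : F[X]} (h : HasCoprimeFamily l c d) (hkl : k ≤ l) :
    HasCoprimeFamily k c d := by
  obtain ⟨S', hS, hcop, hk⟩ := h
  exact ⟨S', hS, hcop, hkl.trans hk⟩

lemma hasCoprimeFamily_of_lines {c d : F[X]} (hcd : IsCoprime c d) (hI : IndepLinear c d)
    (L : Finset (F × F))
    (hL : ∀ l ∈ L, ∀ l' ∈ L, l ≠ l' → ∀ t : F, c.eval t ≠ 0 →
      ¬ (l.1 * t + l.2 = - d.eval t / c.eval t ∧ l'.1 * t + l'.2 = - d.eval t / c.eval t)) :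
    HasCoprimeFamily (L.card + 1) c d := by
  rw [← Finset.card_insertNone]
  have hc : ∀ x : F[X], IsCoprime (1 * c + 0 * d) (x * c + 1 * d) := fun x =>
    isCoprime_of_isCoprime_det hcd (by simpa using isCoprime_one_right)
  refine hasCoprimeFamily_of_index hI (Finset.insertNone L)
    (fun i => i.elim 1 fun l => C l.1 * X + C l.2) (fun i => i.elim 0 fun _ => 1) ?_ ?_ ?_ ?_
  · rintro (_ | l)
    · simp
    · exact degree_linear_le
  · rintro (_ | l) <;> simp
  · rintro (_ | l) (_ | l') hx hy
    · rfl
    · simp at hy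
    · simp at hy
    · have h0 := congrArg (coeff · 0) hx
      have h1 := congrArg (coeff · 1) hx
      simp at h0 h1
      rw [Prod.ext h1 h0]
  · rintro (_ | l) hl (_ | l') hl' hne
    · exact absurd rfl hne
    · exact hc _
    · exact (hc _).symm
    · exact isCoprime_line_combination hcd (fun h => hne (by rw [h]))
        (hL l (by simpa using hl) l' (by simpa using hl') fun h => hne (by rw [h]))

/-- In characteristic `2`, five combinations are pairwise coprime as soon as `c` vanishes at `1` but
not at `0`, and `d` does not vanish at `1`. -/
lemma hasCoprimeFamily_five {c d : F[X]} (hF : (2 : F) = 0) (hcd : IsCoprime c d)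
    (hI : IndepLinear c d) (hc0 : c.eval 0 ≠ 0)
    (hc1 : c.eval 1 = 0) (hd1 : d.eval 1 ≠ 0) : HasCoprimeFamily 5 c d := by
  have h2 : (2 : F[X]) = 0 := by
    rw [← C_ofNat, hF, C_0]
  have hunit : ∀ x y x' y' : F[X], IsUnit (x * y' - x' * y) →
      IsCoprime (x * c + y * d) (x' * c + y' * d) := fun x y x' y' h =>
    isCoprime_of_isCoprime_det hcd (isCoprime_one_right.of_isCoprime_of_dvd_right h.dvd)
  have hlin : ∀ (x y x' y' : F[X]) (a : F) (k : ℕ), x * y' - x' * y = (X - C a) ^ k →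
      (x * c + y * d).eval a ≠ 0 →
      IsCoprime (x * c + y * d) (x' * c + y' * d) := fun x y x' y' a k h h0 =>
    isCoprime_of_isCoprime_det hcd (by
      rw [h]
      exact (isCoprime_X_sub_C_of_eval_ne_zero h0).pow_right)
  refine hasCoprimeFamily_of_index hI (Finset.univ : Finset (Fin 5))
    ![1, 1, X - 1, 0, 1] ![1, X, X, 1, 0] ?_ ?_ ?_ ?_
  · intro i
    have : (X - 1 : F[X]).degree ≤ 1 := by
      rw [← C_1]
      exact degree_X_sub_C_le 1
    fin_cases i <;> simp [this]
  · intro i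
    fin_cases i <;> simp
  · have hX : (X : F[X]) ≠ 1 := X_ne_C 1
    have hX1 : (X - 1 : F[X]) ≠ 0 := sub_ne_zero.2 hX
    have hX2 : (X - 1 : F[X]) ≠ 1 := fun h => X_ne_C (2 : F) (by
      rw [C_ofNat]
      linear_combination h)
    intro i j
    fin_cases i <;> fin_cases j <;>
      simp [hX, hX.symm, X_ne_zero.symm, hX1, hX1.symm, hX2, hX2.symm]
  · have h10 := hlin 1 X 1 1 1 1 (by rw [C_1]; linear_combination (1 - X : F[X]) * h2)
      (by simpa [hc1] using hd1)
    have h20 := hunit (X - 1) X 1 1 (by simp)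
    have h30 := hunit 0 1 1 1 (by simp)
    have h40 := hunit 1 0 1 1 (by simp)
    have h21 := hlin (X - 1) X 1 X 0 2 (by rw [C_0]; linear_combination (-X : F[X]) * h2)
      (by simpa using hc0)
    have h13 := hunit 1 X 0 1 (by simp)
    have h14 := hlin 1 X 1 0 0 1 (by rw [C_0]; linear_combination (-X : F[X]) * h2)
      (by simpa using hc0)
    have h23 := hlin (X - 1) X 0 1 1 1 (by simp) (by simpa using hd1)
    have h24 := hlin (X - 1) X 1 0 0 1 (by rw [C_0]; linear_combination (-X : F[X]) * h2)
      (by simpa using hc0)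
    have h34 := hunit 0 1 1 0 (by simp)
    intro i _ j _ hij
    fin_cases i <;> fin_cases j
    exacts [
      absurd rfl hij, h10.symm, h20.symm, h30.symm, h40.symm,
      h10, absurd rfl hij, h21.symm, h13, h14,
      h20, h21, absurd rfl hij, h23, h24,
      h30, h13.symm, h23.symm, absurd rfl hij, h34,
      h40, h14.symm, h24.symm, h34.symm, absurd rfl hij]

/-- Swapping and shearing reduce to the case where `c` vanishes at `a`. -/
lemma hasCoprimeFamily_of_eval_eq_zero {k : ℕ} (a : F)
    (H : ∀ c d : F[X], IsCoprime c d → IndepLinear c d → c.eval a = 0 → HasCoprimeFamily k c d)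
    {c d : F[X]} (hcd : IsCoprime c d) (hI : IndepLinear c d) : HasCoprimeFamily k c d := by
  by_cases hc : c.eval a = 0
  · exact H c d hcd hI hc
  · refine HasCoprimeFamily.of_shear (a := - d.eval a / c.eval a) (HasCoprimeFamily.swap
      (H _ _ (hcd.add_mul_right_right _).symm (hI.shear _).swap ?_))
    simp only [eval_add, eval_mul, eval_C]
    field_simp
    ring

lemma indepLinear_of_lt_degree {c d : F[X]} (hcd : IsCoprime c d)
    (h : 1 < max c.degree d.degree) : IndepLinear c d := by
  have key : ∀ c d x y : F[X], IsCoprime c d → 1 < c.degree → y.degree ≤ 1 →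
      x * c + y * d = 0 → x = 0 ∧ y = 0 := by
    intro c d x y hcd hc hy h0
    have hdvd : c ∣ y := hcd.dvd_of_dvd_mul_right ⟨-x, by linear_combination h0⟩
    have hy0 : y = 0 := eq_zero_of_dvd_of_degree_lt hdvd (hy.trans_lt hc)
    have hc0 : c ≠ 0 := by
      rintro rfl
      simp at hc
    refine ⟨?_, hy0⟩
    simpa [hy0, hc0] using h0
  intro x y hx hy h0
  rcases lt_max_iff.1 h with h | h
  · exact key c d x y hcd h hy h0
  · exact (key d c y x hcd.symm h hx (by rw [add_comm, h0])).symm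

lemma tPrimes_le_natDegree {p : F[X]} (hp : p ≠ 0) : tPrimes F p ≤ p.natDegree := by
  classical
  rw [tPrimes]
  by_cases hfin : {f : F[X] | f.Monic ∧ Irreducible f ∧ f ∣ p}.Finite
  · rw [Set.ncard_eq_toFinset_card _ hfin]
    have hmem : ∀ f ∈ hfin.toFinset, f.Monic ∧ Irreducible f ∧ f ∣ p := fun f hf =>
      hfin.mem_toFinset.1 hf
    have hdvd : ∏ f ∈ hfin.toFinset, f ∣ p := by
      refine Finset.prod_dvd_of_coprime (fun f hf g hg hfg => ?_) fun f hf => (hmem f hf).2.2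
      have hf' := hmem f hf
      have hg' := hmem g hg
      refine (hf'.2.1.coprime_iff_not_dvd).2 fun h => hfg ?_
      exact eq_of_monic_of_associated hf'.1 hg'.1 (hf'.2.1.associated_of_dvd hg'.2.1 h)
    refine le_trans ?_ (natDegree_le_of_dvd hdvd hp)
    rw [natDegree_prod_of_monic _ _ fun f hf => (hmem f hf).1, Finset.card_eq_sum_ones]
    exact Finset.sum_le_sum fun f hf => (hmem f hf).2.1.natDegree_pos
  · rw [Set.Infinite.ncard hfin]
    exact Nat.zero_le _

variable [Fintype F]

lemma hasCoprimeFamily_two_mul_card_add_one {c d : F[X]} (hcd : IsCoprime c d)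
    (hI : IndepLinear c d) : HasCoprimeFamily (2 * Fintype.card F + 1) c d := by
  classical
  refine hasCoprimeFamily_of_eval_eq_zero 0 (fun c d hcd hI hc0 => ?_) hcd hI
  rcases (Nat.succ_le_of_lt (Fintype.one_lt_card (α := F))).eq_or_lt with hq | hq
  · have hF : ∀ t : F, t ≠ 0 → t = 1 := by
      have h : Fintype.card Fˣ = 1 := by rw [Fintype.card_units, ← hq]
      have := Fintype.card_le_one_iff_subsingleton.1 h.le
      exact fun t ht => congrArg Units.val (Subsingleton.elim (Units.mk0 t ht) 1)
    have h2 : (2 : F) = 0 := by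
      have := FiniteField.cast_card_eq_zero F
      rw [← hq] at this
      exact_mod_cast this
    rw [← hq]
    by_cases hc1 : c.eval 1 = 0
    · refine (hasCoprimeFamily_of_lines hcd hI Finset.univ fun l _ l' _ _ t ht => ?_).mono ?_
      · rcases eq_or_ne t 0 with rfl | ht0
        · exact absurd hc0 ht
        · rw [hF t ht0] at ht
          exact absurd hc1 ht
      · rw [Finset.card_univ, Fintype.card_prod, ← hq]
    · refine HasCoprimeFamily.of_shear (a := - d.eval 1 / c.eval 1) (HasCoprimeFamily.swap
        (hasCoprimeFamily_five h2 (hcd.add_mul_right_right _).symm (hI.shear _).swap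
          ?_ ?_ hc1))
      · intro h0
        obtain ⟨u, v, huv⟩ := hcd
        have := congrArg (eval 0) huv
        simp only [eval_add, eval_mul, eval_C, hc0, mul_zero, add_zero, zero_add] at h0 this
        simp [h0] at this
      · simp only [eval_add, eval_mul, eval_C]
        field_simp
        ring
  · obtain ⟨L, hL, hlines⟩ := exists_lines_of_three_le_card hq fun t => - d.eval t / c.eval t
    refine (hasCoprimeFamily_of_lines hcd hI L fun l hl l' hl' hne t ht =>
      hlines l hl l' hl' hne t ?_).mono (by omega)
    rintro rfl
    exact ht hc0

lemma finite_setOf_degree_le (m : ℕ) : {x : F[X] | x.degree ≤ (m : WithBot ℕ)}.Finite := by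
  have : Finite (degreeLT F (m + 1)) := Finite.of_equiv _ (degreeLTEquiv F (m + 1)).symm.toEquiv
  refine (Set.toFinite (degreeLT F (m + 1) : Set F[X])).subset fun x hx => ?_
  rw [SetLike.mem_coe, mem_degreeLT]
  exact lt_of_le_of_lt hx (by exact_mod_cast Nat.lt_succ_self m)

lemma finite_Sset (c d : F[X]) (m : ℕ) : (Sset F c d m).Finite := by
  refine (((finite_setOf_degree_le m).prod (finite_setOf_degree_le m)).image
    fun v => v.1 * c + v.2 * d).subset ?_
  rintro z ⟨x, y, hx, hy, rfl⟩
  exact ⟨(x, y), ⟨hx, hy⟩, rfl⟩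

lemma HasCoprimeFamily.le_tcd {k : ℕ} {c d : F[X]} (h : HasCoprimeFamily k c d) :
    k ≤ tcd F c d 1 := by
  obtain ⟨S', hS, hcop, hk⟩ := h
  refine hk.trans (le_csSup ⟨(Sset F c d 1).ncard, ?_⟩ ⟨S', hS, hcop, rfl⟩)
  rintro _ ⟨T, hT, -, rfl⟩
  rw [← Set.ncard_coe_finset]
  exact Set.ncard_le_ncard hT (finite_Sset c d 1)

lemma le_tmn_one (n : ℕ) : ((2 * Fintype.card F + 1 : ℕ) : ℕ∞) ≤ tmn F 1 n := by
  refine le_sInf ?_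
  rintro _ ⟨c, d, hcd, hlt, -, rfl⟩
  have h1 : 1 < max c.degree d.degree := lt_trans (by norm_num) hlt
  exact_mod_cast (hasCoprimeFamily_two_mul_card_add_one hcd
    (indepLinear_of_lt_degree hcd h1)).le_tcd

lemma tcd_X_sq_le : tcd F (X ^ 2) (X + 1) 0 ≤ Fintype.card F + 1 := by
  classical
  refine csSup_le ⟨0, ∅, by simp⟩ ?_
  rintro _ ⟨S', hS, hcop, rfl⟩
  have hform : ∀ z ∈ S', ∃ a b : F, z = C a * X ^ 2 + C b * (X + 1) := by
    intro z hz
    obtain ⟨x, y, hx, hy, rfl⟩ := hS hz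
    exact ⟨x.coeff 0, y.coeff 0, by rw [← eq_C_of_degree_le_zero hx, ← eq_C_of_degree_le_zero hy]⟩
  have hcoeff : ∀ a b : F, (C a * X ^ 2 + C b * (X + 1)).coeff 2 = a ∧
      (C a * X ^ 2 + C b * (X + 1)).coeff 1 = b := by
    intro a b
    constructor <;> simp [coeff_X, coeff_one]
  have hnotunit : ∀ z : F[X], z ∣ 1 → z.coeff 2 = 0 ∧ z.coeff 1 = 0 := by
    intro z hz
    obtain ⟨r, -, rfl⟩ := isUnit_iff.1 (isUnit_of_dvd_one hz)
    simp
  have hcard := Finset.card_le_card_of_injOn (s := S') (t := (Finset.univ : Finset (Option F)))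
    (fun z => if z.coeff 2 = 0 then none else some (z.coeff 1 / z.coeff 2))
    (fun _ _ => Finset.mem_coe.2 (Finset.mem_univ _)) ?_
  · simpa using hcard
  · intro z hz z' hz' hzz
    by_contra hne
    have hc := hcop z hz z' hz' hne
    obtain ⟨a, b, rfl⟩ := hform z hz
    obtain ⟨a', b', rfl⟩ := hform z' hz'
    simp only [hcoeff] at hzz
    by_cases ha : a = 0 <;> by_cases ha' : a' = 0
    · subst ha ha'
      have h := hnotunit (X + 1) (hc.isUnit_of_dvd' (x := X + 1) ⟨C b, by rw [C_0]; ring⟩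
        ⟨C b', by rw [C_0]; ring⟩).dvd
      simp [coeff_X, coeff_one] at h
    · simp [ha, ha'] at hzz
    · simp [ha, ha'] at hzz
    · simp only [ha, ha', if_false, Option.some.injEq] at hzz
      have hb : b' = a' / a * b := by
        field_simp at hzz ⊢
        linear_combination -hzz
      have ha2 : a' = a' / a * a := by field_simp
      have h := hnotunit _ (hc.isUnit_of_dvd' dvd_rfl ⟨C (a' / a), by
        rw [hb]
        nth_rewrite 1 [ha2]
        rw [C_mul, C_mul]
        ring⟩).dvd
      exact ha ((hcoeff a b).1.symm.trans h.1)

lemma tmn_zero_le {n : ℕ} (hn : 3 ≤ n) :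
    tmn F 0 n ≤ ((Fintype.card F + 1 : ℕ) : ℕ∞) := by
  have hX : (X + 1 : F[X]).degree = 1 := by
    rw [← C_1]
    exact degree_X_add_C 1
  have hmax : max (X ^ 2 : F[X]).degree (X + 1 : F[X]).degree = ((2 : ℕ) : WithBot ℕ) := by
    rw [hX, degree_X_pow]
    decide
  refine (sInf_le (a := (tcd F (X ^ 2) (X + 1) 0 : ℕ∞)) ?_).trans (Nat.cast_le.2 tcd_X_sq_le)
  refine ⟨X ^ 2, X + 1, ⟨1, 1 - X, by ring⟩, ?_, ?_, rfl⟩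
  · rw [hmax]
    decide
  · rw [hmax]
    exact_mod_cast hn

end PairwiseCoprime

/-- If `q < t(𝔫) ≤ 2q`, where `t(𝔫)` is the number of distinct monic prime
factors of `𝔫`, then `τ(𝔫) = 1`. -/
theorem tau_eq_one
    (Fq : Type) [Field Fq] [Fintype Fq]
    (𝔫 : Polynomial Fq) (h𝔫 : 𝔫.Monic)
    (ht1 : Fintype.card Fq < tPrimes Fq 𝔫) (ht2 : tPrimes Fq 𝔫 ≤ 2 * Fintype.card Fq) :
    tauN Fq 𝔫 = 1 := by
  have hdeg : 3 ≤ 𝔫.natDegree := by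
    have h1 : 1 < Fintype.card Fq := Fintype.one_lt_card
    have h2 := tPrimes_le_natDegree h𝔫.ne_zero
    omega
  have hone : 1 ∈ { m : ℕ | (tPrimes Fq 𝔫 : ℕ∞) < tmn Fq m 𝔫.natDegree } :=
    lt_of_lt_of_le (Nat.cast_lt.2 (Nat.lt_succ_of_le ht2)) (le_tmn_one 𝔫.natDegree)
  refine le_antisymm (Nat.sInf_le hone) (Nat.one_le_iff_ne_zero.2 fun h => ?_)
  have hzero : 0 ∈ { m : ℕ | (tPrimes Fq 𝔫 : ℕ∞) < tmn Fq m 𝔫.natDegree } :=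
    h ▸ Nat.sInf_mem ⟨1, hone⟩
  exact absurd ((tmn_zero_le hdeg).trans (Nat.cast_le.2 ht1)) (not_le.2 hzero)
end SturmFF
end
end

section
/- Vanishing of the constant Fourier coefficient: Let 𝔫 ∈ A₊ and f ∈ H(𝔫). If c_𝔪(f) = 0 for every 𝔪 ∈ A₊ with deg 𝔪 < deg 𝔫, then c₀(f) = 0. -/
open Polynomial Matrix

noncomputable section

namespace SturmFF

variable (Fq : Type) [Field Fq] [Fintype Fq]

section FourierAnalysis

variable {Fq}

omit [Fintype Fq] in
lemma polyToK_C (c : Fq) : polyToK Fq (C c) = HahnSeries.single 0 c := by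
  simp [polyToK, HahnSeries.algebraMap_apply']

omit [Fintype Fq] in
lemma polyToK_eq_sum (P : Polynomial Fq) {d : ℕ} (hd : P.natDegree ≤ d) :
    polyToK Fq P = ∑ j : Fin (d + 1), HahnSeries.single (-(j : ℤ)) (P.coeff j) := by
  have h1 : polyToK Fq P = aeval (thetaK Fq) P := rfl
  rw [h1, aeval_eq_sum_range' (Nat.lt_succ_of_le hd), Finset.sum_range]
  refine Finset.sum_congr rfl fun j _ => ?_
  rw [Algebra.smul_def, HahnSeries.algebraMap_apply']
  simp [thetaK, HahnSeries.single_pow]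

omit [Fintype Fq] in
lemma piInf_pow (k : ℕ) : piInf Fq ^ k = HahnSeries.single (k : ℤ) 1 := by
  simp [piInf, HahnSeries.single_pow]

omit [Fintype Fq] in
lemma piInf_ne_zero : piInf Fq ≠ 0 := by
  simp [piInf]

omit [Fintype Fq] in
lemma coeff_polyToK_mul_piInf_pow (P : Polynomial Fq) (n : ℤ) :
    (polyToK Fq P * piInf Fq ^ P.natDegree).coeff n =
      ∑ j : Fin (P.natDegree + 1),
        if n = (P.natDegree : ℤ) - (j : ℤ) then P.coeff j else 0 := by
  rw [polyToK_eq_sum P le_rfl, piInf_pow, Finset.sum_mul, HahnSeries.coeff_sum]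
  refine Finset.sum_congr rfl fun j _ => ?_
  rw [HahnSeries.single_mul_single, HahnSeries.coeff_single, mul_one]
  simp only [neg_add_eq_sub]

omit [Fintype Fq] in
lemma coeff_polyToK_mul_piInf_pow_of_neg (P : Polynomial Fq) {n : ℤ} (hn : n < 0) :
    (polyToK Fq P * piInf Fq ^ P.natDegree).coeff n = 0 := by
  rw [coeff_polyToK_mul_piInf_pow]
  refine Finset.sum_eq_zero fun j _ => if_neg ?_
  have := j.is_lt
  omega

omit [Fintype Fq] in
lemma Monic.coeff_zero_polyToK_mul_piInf_pow {P : Polynomial Fq} (hP : P.Monic) :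
    (polyToK Fq P * piInf Fq ^ P.natDegree).coeff 0 = 1 := by
  rw [coeff_polyToK_mul_piInf_pow, Finset.sum_eq_single (Fin.last P.natDegree)]
  · simp [hP.coeff_natDegree]
  · intro j _ hj
    refine if_neg fun h => hj (Fin.ext ?_)
    simp only [Fin.val_last]
    omega
  · simp

omit [Fintype Fq] in
lemma coeff_one_polyToK_mul_uOf (P : Polynomial Fq) {d : ℕ} (hd : P.natDegree ≤ d)
    (v : Fin (d + 1) → Fq) :
    (polyToK Fq P * uOf Fq d v).coeff 1 = ∑ i : Fin (d + 1), P.coeff i * v i := by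
  rw [polyToK_eq_sum P hd, uOf, Finset.sum_mul, HahnSeries.coeff_sum]
  refine Finset.sum_congr rfl fun j _ => ?_
  rw [Finset.mul_sum, HahnSeries.coeff_sum, Finset.sum_eq_single j]
  · rw [HahnSeries.single_mul_single, HahnSeries.coeff_single, if_pos (by omega)]
  · intro i _ hi
    rw [HahnSeries.single_mul_single, HahnSeries.coeff_single, if_neg]
    intro h
    exact hi (Fin.ext (by omega))
  · simp

variable (Fq) in
/-- The additive character of `Fq` underlying `psi`. -/
def residueChar : AddChar Fq ℂ :=
  have : NeZero (ringChar Fq) := ⟨CharP.ringChar_ne_zero_of_finite Fq⟩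
  letI := ZMod.algebra Fq (ringChar Fq)
  (ZMod.stdAddChar (N := ringChar Fq)).compAddMonoidHom
    (Algebra.trace (ZMod (ringChar Fq)) Fq).toAddMonoidHom

lemma psi_eq_residueChar (x : Kinf Fq) : psi Fq x = residueChar Fq (x.coeff 1) := by
  have : NeZero (ringChar Fq) := ⟨CharP.ringChar_ne_zero_of_finite Fq⟩
  simp only [psi, residueChar, AddChar.compAddMonoidHom_apply, ZMod.stdAddChar_apply]
  exact (ZMod.toCircle_apply _).symm

lemma residueChar_isPrimitive : (residueChar Fq).IsPrimitive := by
  have : NeZero (ringChar Fq) := ⟨CharP.ringChar_ne_zero_of_finite Fq⟩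
  let := ZMod.algebra Fq (ringChar Fq)
  refine AddChar.IsPrimitive.of_ne_one (AddChar.ne_one_iff.mpr ?_)
  obtain ⟨b, hb⟩ := FiniteField.trace_to_zmod_nondegenerate Fq (one_ne_zero (α := Fq))
  refine ⟨b, fun h => hb ?_⟩
  rw [one_mul]
  apply ZMod.injective_stdAddChar
  rw [AddChar.map_zero_eq_one]
  exact h

lemma sum_addChar_dotProduct [DecidableEq Fq] {χ : AddChar Fq ℂ} (hχ : χ.IsPrimitive) {k : ℕ}
    (x : Fin k → Fq) :
    ∑ m : Fin k → Fq, χ (∑ i, m i * x i) = if x = 0 then (Fintype.card Fq : ℂ) ^ k else 0 := by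
  have h1 (m : Fin k → Fq) : χ (∑ i, m i * x i) = ∏ i, χ (m i * x i) :=
    (congrArg χ.toMonoidHom (ofAdd_sum Finset.univ fun i => m i * x i)).trans
      (map_prod χ.toMonoidHom _ _)
  simp_rw [h1]
  rw [← Fintype.prod_sum (fun i a => χ (a * x i))]
  simp_rw [AddChar.sum_mulShift _ hχ]
  split_ifs with hx
  · simp [hx]
  · obtain ⟨i, hi⟩ := Function.ne_iff.mp hx
    exact Finset.prod_eq_zero (Finset.mem_univ i) (by simpa using hi)

/-- A function on `Fq ^ (d + 1)` whose Fourier transform is supported on the vectors with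
vanishing last coordinate does not depend on the last coordinate. -/
lemma eq_of_fourier_eq_zero {χ : AddChar Fq ℂ} (hχ : χ.IsPrimitive) {d : ℕ}
    (G : (Fin (d + 1) → Fq) → ℂ)
    (hG : ∀ m : Fin (d + 1) → Fq, m (Fin.last d) ≠ 0 →
      ∑ v, G v * χ (-∑ i, m i * v i) = 0)
    {w w' : Fin (d + 1) → Fq} (hw : Fin.init w = Fin.init w') : G w = G w' := by
  classical
  have inversion (w : Fin (d + 1) → Fq) :
      ∑ m : Fin (d + 1) → Fq, χ (∑ i, m i * w i) * ∑ v, G v * χ (-∑ i, m i * v i) =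
        (Fintype.card Fq : ℂ) ^ (d + 1) * G w := by
    simp_rw [Finset.mul_sum]
    rw [Finset.sum_comm]
    have h1 (v : Fin (d + 1) → Fq) :
        ∑ m : Fin (d + 1) → Fq, χ (∑ i, m i * w i) * (G v * χ (-∑ i, m i * v i)) =
          G v * if w - v = 0 then (Fintype.card Fq : ℂ) ^ (d + 1) else 0 := by
      rw [← sum_addChar_dotProduct hχ, Finset.mul_sum]
      refine Finset.sum_congr rfl fun m _ => ?_
      rw [mul_left_comm, ← AddChar.map_add_eq_mul, ← sub_eq_add_neg, ← Finset.sum_sub_distrib]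
      simp only [Pi.sub_apply, mul_sub]
    simp_rw [h1, sub_eq_zero]
    simp [mul_comm]
  have hq : (Fintype.card Fq : ℂ) ^ (d + 1) ≠ 0 := pow_ne_zero _ (by simp)
  apply mul_left_cancel₀ hq
  rw [← inversion w, ← inversion w']
  refine Finset.sum_congr rfl fun m _ => ?_
  by_cases hm : m (Fin.last d) = 0
  · have h2 (i : Fin d) : w i.castSucc = w' i.castSucc := congrFun hw i
    simp [Fin.sum_univ_castSucc (n := d), hm, h2]
  · simp [hG m hm]

omit [Fintype Fq] in
/-- There is a monic polynomial with prescribed lower coefficients. -/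
lemma exists_monic_coeff_eq {d : ℕ} (m : Fin (d + 1) → Fq) (hm : m (Fin.last d) = 1) :
    ∃ P : Polynomial Fq, P.Monic ∧ P.natDegree = d ∧ ∀ i : Fin (d + 1), P.coeff i = m i := by
  have hc (i : Fin (d + 1)) : (∑ j : Fin (d + 1), monomial (j : ℕ) (m j)).coeff i = m i := by
    simp [coeff_monomial, Fin.val_inj]
  have hle : (∑ j : Fin (d + 1), monomial (j : ℕ) (m j)).natDegree ≤ d :=
    natDegree_sum_le_of_forall_le _ _ fun j _ =>
      (natDegree_monomial_le _).trans (Nat.lt_succ_iff.mp j.is_lt)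
  have hd := (hc (Fin.last d)).trans hm
  rw [Fin.val_last] at hd
  exact ⟨_, monic_of_natDegree_le_of_coeff_eq_one d hle hd,
    natDegree_eq_of_le_of_coeff_ne_zero hle (by simp [hd]), hc⟩

end FourierAnalysis

section Cochain

variable {Fq} {𝔫 : Polynomial Fq} {f : Matrix (Fin 2) (Fin 2) (Kinf Fq) → ℂ}

omit [Fintype Fq] in
lemma memO_single {n : ℤ} (hn : 0 ≤ n) (a : Fq) : memO Fq (HahnSeries.single n a) := by
  intro m hm
  rw [HahnSeries.coeff_single, if_neg (by omega)]

omit [Fintype Fq] in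
lemma memO_one : memO Fq 1 := memO_single le_rfl 1

omit [Fintype Fq] in
lemma memO_zero : memO Fq 0 := fun _ _ => rfl

omit [Fintype Fq] in
lemma inIw_upper {a b d : Fq} (ha : a ≠ 0) (hd : d ≠ 0) :
    InIw Fq !![HahnSeries.single 0 a, HahnSeries.single 0 b; 0, HahnSeries.single 0 d] := by
  refine ⟨⟨?_, ?_⟩, fun n _ => rfl⟩
  · intro i j
    fin_cases i <;> fin_cases j
    exacts [memO_single le_rfl a, memO_single le_rfl b, memO_zero, memO_single le_rfl d]
  · simp [Matrix.det_fin_two_of, ha, hd]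

omit [Fintype Fq] in
lemma inIw_one : InIw Fq 1 := by
  have := inIw_upper (b := 0) (one_ne_zero (α := Fq)) (one_ne_zero (α := Fq))
  rwa [map_zero, HahnSeries.single_zero_one, ← Matrix.one_fin_two] at this

omit [Fintype Fq] in
lemma inGamma0_one : InGamma0 Fq 𝔫 1 := by
  simp [InGamma0]

variable (Fq) in
/-- The representative `(π_∞ ^ k, u; 0, 1)` of an edge of the Bruhat–Tits tree. -/
def edge (k : ℕ) (u : Kinf Fq) : Matrix (Fin 2) (Fin 2) (Kinf Fq) := !![piInf Fq ^ k, u; 0, 1]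

omit [Fintype Fq] in
lemma edge_det_ne_zero (k : ℕ) (u : Kinf Fq) : (edge Fq k u).det ≠ 0 := by
  simp [edge, Matrix.det_fin_two_of, piInf_ne_zero]

namespace Harmonic

lemma apply_right (hf : Harmonic Fq 𝔫 f) {g κ : Matrix (Fin 2) (Fin 2) (Kinf Fq)} {z : Kinf Fq}
    (hg : g.det ≠ 0) (hz : z ≠ 0) (hκ : InIw Fq κ) : f (z • (g * κ)) = f g := by
  have := hf.1 g hg 1 inGamma0_one z hz κ hκ
  simpa using this

lemma apply_left (hf : Harmonic Fq 𝔫 f) {g : Matrix (Fin 2) (Fin 2) (Kinf Fq)}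
    {γ : Matrix (Fin 2) (Fin 2) (Polynomial Fq)}
    (hg : g.det ≠ 0) (hγ : InGamma0 Fq 𝔫 γ) : f (γ.map (polyToK Fq) * g) = f g := by
  have := hf.1 g hg γ hγ 1 one_ne_zero 1 inIw_one
  simpa using this

lemma edge_mul_lower (hf : Harmonic Fq 𝔫 f) (k : ℕ) (u : Kinf Fq) {ε : Fq} (hε : ε ≠ 0) :
    f (edge Fq k u * !![1, 0; polyToK Fq (C ε), 1]) =
      -f (edge Fq (k + 1) (u + polyToK Fq (C ε⁻¹) * piInf Fq ^ k)) := by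
  have hπ := piInf_ne_zero (Fq := Fq)
  have hε' : polyToK Fq (C ε⁻¹) * polyToK Fq (C ε) = 1 := by
    rw [← map_mul, ← C_mul, inv_mul_cancel₀ hε, C_1, map_one]
  rw [← hf.2.1 _ (edge_det_ne_zero _ _)]
  have hdet : (edge Fq (k + 1) (u + polyToK Fq (C ε⁻¹) * piInf Fq ^ k) * Jmat Fq).det ≠ 0 := by
    rw [Matrix.det_mul]
    exact mul_ne_zero (edge_det_ne_zero _ _) (by simp [Jmat, Matrix.det_fin_two_of, hπ])
  rw [← hf.apply_right hdet (inv_ne_zero hπ)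
    (inIw_upper (b := 1) hε (neg_ne_zero.mpr (inv_ne_zero hε)))]
  congr 1
  simp only [← polyToK_C, map_neg, edge, Jmat]
  generalize polyToK Fq (C ε⁻¹) = b at hε' ⊢
  refine Matrix.ext fun i j => ?_
  fin_cases i <;> fin_cases j <;> simp [pow_succ, hπ]
  · field_simp
    linear_combination -piInf Fq ^ k * hε'
  · field_simp
    ring

lemma edge_mul_swap (hf : Harmonic Fq 𝔫 f) (k : ℕ) (u : Kinf Fq) :
    f (edge Fq k u * !![0, 1; 1, 0]) = -f (edge Fq (k + 1) u) := by
  have hπ := piInf_ne_zero (Fq := Fq)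
  rw [← hf.2.1 _ (edge_det_ne_zero _ _)]
  have hdet : (edge Fq (k + 1) u * Jmat Fq).det ≠ 0 := by
    rw [Matrix.det_mul]
    exact mul_ne_zero (edge_det_ne_zero _ _) (by simp [Jmat, Matrix.det_fin_two_of, hπ])
  rw [← hf.apply_right hdet (inv_ne_zero hπ) inIw_one]
  congr 1
  simp only [edge, Jmat]
  refine Matrix.ext fun i j => ?_
  fin_cases i <;> fin_cases j <;> simp [pow_succ] <;> field_simp

lemma edge_eq_sum (hf : Harmonic Fq 𝔫 f) (k : ℕ) (u : Kinf Fq) :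
    f (edge Fq k u) =
      ∑ c : Fq, f (edge Fq (k + 1) (u + polyToK Fq (C c) * piInf Fq ^ k)) := by
  classical
  have h := hf.2.2 _ (edge_det_ne_zero k u)
  rw [hf.edge_mul_swap, ← Finset.add_sum_erase _ _ (Finset.mem_univ (0 : Fq)),
    Finset.sum_congr rfl fun ε hε => hf.edge_mul_lower k u (Finset.ne_of_mem_erase hε)] at h
  rw [← Equiv.sum_comp (Equiv.inv Fq), ← Finset.add_sum_erase _ _ (Finset.mem_univ (0 : Fq))]
  have h1 : !![1, 0; polyToK Fq (C (0 : Fq)), 1] = 1 := by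
    rw [Matrix.one_fin_two, C_0, map_zero]
  rw [h1, mul_one, Finset.sum_neg_distrib] at h
  simp only [Equiv.inv_apply, _root_.inv_zero, map_zero, zero_mul, add_zero]
  linear_combination h

lemma edge_smul (hf : Harmonic Fq 𝔫 f) (k : ℕ) (u : Kinf Fq) {α : Fq} (hα : α ≠ 0) :
    f (edge Fq k (polyToK Fq (C α) * u)) = f (edge Fq k u) := by
  have hα' : polyToK Fq (C α) * polyToK Fq (C α⁻¹) = 1 := by
    rw [← map_mul, ← C_mul, mul_inv_cancel₀ hα, C_1, map_one]
  have hγ : InGamma0 Fq 𝔫 !![C α, 0; 0, 1] := by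
    simp [InGamma0, Matrix.det_fin_two_of, hα]
  have h := hf.1 _ (edge_det_ne_zero k u) _ hγ 1 one_ne_zero _
    (inIw_upper (b := 0) (inv_ne_zero hα) one_ne_zero)
  rw [← h]
  congr 1
  simp only [← polyToK_C, edge]
  refine Matrix.ext fun i j => ?_
  fin_cases i <;> fin_cases j <;> simp [Matrix.mul_apply]
  linear_combination -piInf Fq ^ k * hα'

lemma edge_add_polyToK (hf : Harmonic Fq 𝔫 f) (k : ℕ) (u : Kinf Fq) (a : Polynomial Fq) :
    f (edge Fq k (u + polyToK Fq a)) = f (edge Fq k u) := by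
  have hγ : InGamma0 Fq 𝔫 !![1, a; 0, 1] := by
    simp [InGamma0, Matrix.det_fin_two_of]
  rw [← hf.apply_left (edge_det_ne_zero k u) hγ]
  congr 1
  simp only [edge]
  refine Matrix.ext fun i j => ?_
  fin_cases i <;> fin_cases j <;> simp [Matrix.mul_apply]

/-- The element `(1, 0; 𝔫, 1)` of `Γ₀(𝔫)` reverses an edge up to translation. -/
lemma edge_reverse (hf : Harmonic Fq 𝔫 f) (h𝔫 : 𝔫.Monic) :
    f (edge Fq 𝔫.natDegree 0) =
      -f (edge Fq (𝔫.natDegree + 1) (piInf Fq ^ 𝔫.natDegree)) := by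
  set η := polyToK Fq 𝔫 * piInf Fq ^ 𝔫.natDegree with hη
  have h0 : η.coeff 0 = 1 := Monic.coeff_zero_polyToK_mul_piInf_pow h𝔫
  have hneg (m : ℤ) (hm : m < 0) : η.coeff m = 0 := coeff_polyToK_mul_piInf_pow_of_neg 𝔫 hm
  have hκ : InIw Fq !![1, 1; 1 - η, -η] := by
    have hone (m : ℤ) (hm : m < 0) : (1 : Kinf Fq).coeff m = 0 := memO_one m hm
    refine ⟨⟨?_, ?_⟩, ?_⟩
    · intro i j m hm
      fin_cases i <;> fin_cases j <;> simp [-HahnSeries.coeff_one, hone m hm, hneg m hm]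
    · rw [Matrix.det_fin_two_of, show 1 * -η - 1 * (1 - η) = -1 by ring]
      simp
    · intro m hm
      rcases (Int.le_of_lt_add_one hm : m ≤ 0).lt_or_eq with hm | rfl
      · simp [-HahnSeries.coeff_one, hone m hm, hneg m hm]
      · simp [h0]
  have hγ : InGamma0 Fq 𝔫 !![1, 0; 𝔫, 1] := by
    simp [InGamma0, Matrix.det_fin_two_of]
  rw [← hf.2.1 _ (edge_det_ne_zero _ _),
    ← hf.1 _ (edge_det_ne_zero 𝔫.natDegree 0) _ hγ _ piInf_ne_zero _ hκ]
  congr 1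
  simp only [edge, Jmat]
  refine Matrix.ext fun i j => ?_
  fin_cases i <;> fin_cases j <;> simp [pow_succ, Matrix.mul_apply, ← hη] <;> ring

/-- Vanishing of the coefficients of degree `d` kills the part of the Fourier transform
supported on vectors with nonzero last coordinate. -/
lemma fourier_eq_zero (hf : Harmonic Fq 𝔫 f) {d : ℕ}
    (h : ∀ 𝔪 : Polynomial Fq, 𝔪.Monic → 𝔪.natDegree = d → cm Fq 𝔪 f = 0)
    {m : Fin (d + 1) → Fq} (hm : m (Fin.last d) ≠ 0) :
    ∑ v, f (edge Fq (d + 2) (uOf Fq d v)) * residueChar Fq (-∑ i, m i * v i) = 0 := by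
  set α := m (Fin.last d) with hα
  obtain ⟨P, hP, rfl, hc⟩ := exists_monic_coeff_eq (fun i => α⁻¹ * m i) (inv_mul_cancel₀ hm)
  have h1 := h P hP rfl
  rw [cm, mul_eq_zero, or_iff_right (by simp)] at h1
  rw [← h1, ← Equiv.sum_comp (Equiv.piCongrRight fun _ => Equiv.mulLeft₀ α⁻¹ (inv_ne_zero hm))]
  refine Finset.sum_congr rfl fun v _ => ?_
  have hu : uOf Fq P.natDegree (fun i => α⁻¹ * v i) =
      polyToK Fq (C α⁻¹) * uOf Fq P.natDegree v := by
    simp only [uOf, polyToK_C, Finset.mul_sum, HahnSeries.single_mul_single, zero_add]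
  change f (edge Fq _ (uOf Fq _ fun i => α⁻¹ * v i)) *
    residueChar Fq (-∑ i, m i * (α⁻¹ * v i)) = _
  rw [hu, hf.edge_smul _ _ (inv_ne_zero hm), psi_eq_residueChar, HahnSeries.coeff_neg,
    coeff_one_polyToK_mul_uOf P le_rfl]
  simp only [hc, edge, mul_left_comm, mul_assoc]

/-- If the coefficients of degree less than `deg 𝔫` vanish, the values on the edges up to level
`deg 𝔫 + 1` are constant at each level. -/
lemma card_pow_mul_edge (hf : Harmonic Fq 𝔫 f)
    (h : ∀ 𝔪 : Polynomial Fq, 𝔪.Monic → 𝔪.natDegree < 𝔫.natDegree → cm Fq 𝔪 f = 0)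
    {k : ℕ} (hk : k ≤ 𝔫.natDegree) (c : Fin k → Fq) :
    (Fintype.card Fq : ℂ) ^ k *
        f (edge Fq (k + 1) (∑ i : Fin k, HahnSeries.single ((i : ℤ) + 1) (c i))) =
      f (edge Fq 1 0) := by
  induction k with
  | zero => simp
  | succ d ih =>
    have hconst {w w' : Fin (d + 1) → Fq} (hw : Fin.init w = Fin.init w') :
        f (edge Fq (d + 2) (uOf Fq d w)) = f (edge Fq (d + 2) (uOf Fq d w')) :=
      eq_of_fourier_eq_zero residueChar_isPrimitive
        (fun v => f (edge Fq (d + 2) (uOf Fq d v)))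
        (fun m hm => hf.fourier_eq_zero (fun P hP hd => h P hP (by omega)) hm) hw
    rw [← ih (by omega) (Fin.init c), hf.edge_eq_sum (d + 1)]
    have hsum (a : Fq) : f (edge Fq (d + 1 + 1)
        (∑ i : Fin d, HahnSeries.single ((i : ℤ) + 1) (Fin.init c i) +
          polyToK Fq (C a) * piInf Fq ^ (d + 1))) = f (edge Fq (d + 2) (uOf Fq d c)) := by
      rw [hconst (w := c) (w' := Fin.snoc (α := fun _ => Fq) (Fin.init c) a) (by simp)]
      simp [uOf, Fin.sum_univ_castSucc, polyToK_C, piInf_pow]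
    simp_rw [hsum]
    simp only [Finset.sum_const, Finset.card_univ, nsmul_eq_mul, uOf]
    ring

end Harmonic

end Cochain

/-- **Vanishing of the constant Fourier coefficient**: if `c_𝔪(f) = 0` for all
monic `𝔪` with `deg 𝔪 < deg 𝔫`, then `c₀(f) = 0`. -/
theorem constant_coefficient_vanishes
    (Fq : Type) [Field Fq] [Fintype Fq]
    (𝔫 : Polynomial Fq) (h𝔫 : 𝔫.Monic)
    (f : Matrix (Fin 2) (Fin 2) (Kinf Fq) → ℂ) (hf : Harmonic Fq 𝔫 f)
    (h : ∀ 𝔪 : Polynomial Fq, 𝔪.Monic → 𝔪.natDegree < 𝔫.natDegree → cm Fq 𝔪 f = 0) :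
    c0 Fq f = 0 := by
  have hq : (Fintype.card Fq : ℂ) ≠ 0 := by simp
  have hc0 : c0 Fq f = (Fintype.card Fq : ℂ)⁻¹ * f (edge Fq 1 0) := by
    rw [hf.edge_eq_sum 1 0]
    simp [c0, edge]
  have hrev := hf.edge_reverse h𝔫
  have hzero : f (edge Fq 1 0) = 0 := by
    rcases hn : 𝔫.natDegree with _ | d
    · have h0 := hf.edge_eq_sum 0 0
      have h1 := hf.edge_add_polyToK 1 0
      simp only [zero_add] at h1
      simp only [pow_zero, mul_one, zero_add, h1, Finset.sum_const, Finset.card_univ,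
        nsmul_eq_mul] at h0
      rw [hn, pow_zero, zero_add, h0, ← map_one (polyToK Fq), h1] at hrev
      have : ((Fintype.card Fq + 1 : ℕ) : ℂ) * f (edge Fq 1 0) = 0 := by
        push_cast
        linear_combination hrev
      exact (mul_eq_zero.mp this).resolve_left (Nat.cast_ne_zero.mpr (Nat.succ_ne_zero _))
    · have h0 := hf.card_pow_mul_edge h (k := d) (by omega) 0
      have h1 := hf.card_pow_mul_edge h (k := d + 1) (by omega)
        (Fin.snoc (α := fun _ => Fq) 0 1)
      simp only [Fin.sum_univ_castSucc, Fin.snoc_castSucc, Fin.snoc_last, Pi.zero_apply, map_zero,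
        Finset.sum_const_zero, zero_add, Fin.val_last] at h0 h1
      rw [hn, piInf_pow] at hrev
      push_cast at hrev
      have : ((Fintype.card Fq + 1 : ℕ) : ℂ) * f (edge Fq 1 0) = 0 := by
        push_cast
        linear_combination (Fintype.card Fq : ℂ) ^ (d + 1) * hrev - h1 -
          (Fintype.card Fq : ℂ) * h0
      exact (mul_eq_zero.mp this).resolve_left (Nat.cast_ne_zero.mpr (Nat.succ_ne_zero _))
  rw [hc0, hzero, mul_zero]

end SturmFF
end
end
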